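/- There exist absolute constants C, c > 0 such that if n ≥ C d, then with probability at least 1 − C/n − C e^{−c n} over the draw of x_1, …, x_n, the smallest eigenvalue of the Hessian at the ground truth satisfies λ_min(∇²L(w*)) ≥ c > 0; equivalently, u^⊤ ∇²L(w*) u = (2/n) Σ_{i=1}^n (u^⊤ x_i)² (w*^⊤ x_i)² ≥ c for all unit vectors u ∈ S^{d−1}. -/

import Mathlib

open MeasureTheory ProbabilityTheory Real

noncomputable section

/-- Euclidean inner product on `Fin d → ℝ`. -/
def dot {d : ℕ} (u v : Fin d → ℝ) : ℝ := ∑ j, u j * v j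

/-- Euclidean norm on `Fin d → ℝ`. -/
def nrm {d : ℕ} (u : Fin d → ℝ) : ℝ := Real.sqrt (∑ j, (u j) ^ 2)

/-- Standard Gaussian `N(0, I_d)` on `Fin d → ℝ`. -/
def stdGaussian (d : ℕ) : Measure (Fin d → ℝ) := Measure.pi fun _ => gaussianReal 0 1

/-- Law of `n` i.i.d. draws from `N(0, I_d)`. -/
def sample (n d : ℕ) : Measure (Fin n → Fin d → ℝ) := Measure.pi fun _ => stdGaussian d

lemma nrm_eq_norm {d : ℕ} (u : Fin d → ℝ) : nrm u = ‖WithLp.toLp 2 u‖ := by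
  simp [nrm, EuclideanSpace.norm_eq]

lemma measurable_dot {d : ℕ} (v : Fin d → ℝ) : Measurable (fun x : Fin d → ℝ => dot v x) := by
  unfold dot
  fun_prop

lemma dot_law {d : ℕ} (v : Fin d → ℝ) :
    (Measure.pi fun _ : Fin d => gaussianReal 0 1).map (fun x => dot v x)
      = gaussianReal 0 (Real.toNNReal (∑ j, (v j) ^ 2)) := by
  have hm := measurable_dot v
  have : IsProbabilityMeasure ((Measure.pi fun _ : Fin d => gaussianReal 0 1).map
      (fun x => dot v x)) := Measure.isProbabilityMeasure_map hm.aemeasurable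
  apply Measure.ext_of_charFun
  ext t
  rw [charFun_apply_real, integral_map hm.aemeasurable (by fun_prop)]
  have h1 : ∀ x : Fin d → ℝ, Complex.exp ((t : ℂ) * (dot v x : ℝ) * Complex.I)
      = ∏ j, Complex.exp (((t * v j : ℝ) : ℂ) * (x j : ℝ) * Complex.I) := by
    intro x
    rw [← Complex.exp_sum]
    congr 1
    simp only [dot]
    push_cast
    rw [Finset.mul_sum, Finset.sum_mul]
    exact Finset.sum_congr rfl fun j _ => by ring
  simp_rw [h1]
  rw [integral_fintype_prod_eq_prod
    (f := fun j (y : ℝ) => Complex.exp (((t * v j : ℝ) : ℂ) * (y : ℝ) * Complex.I))]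
  simp_rw [← charFun_apply_real, charFun_gaussianReal]
  rw [← Complex.exp_sum]
  congr 1
  have h0 : (0 : ℝ) ≤ ∑ j, (v j) ^ 2 := Finset.sum_nonneg fun j _ => sq_nonneg _
  rw [Real.coe_toNNReal _ h0]
  push_cast
  simp only [mul_zero, zero_mul, zero_sub]
  rw [Finset.sum_neg_distrib, Finset.sum_mul, Finset.sum_div]
  congr 1
  exact Finset.sum_congr rfl fun j _ => by ring

lemma gauss_small (s : NNReal) (hs : s ≠ 0) (t : ℝ) (ht : 0 ≤ t) :
    (gaussianReal 0 s).real {y | |y| < t} ≤ t / √s := by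
  have hset : {y : ℝ | |y| < t} = Set.Ioo (-t) t := by
    ext y; simp [abs_lt]
  have hs0 : (0 : ℝ) < s := by positivity
  rw [hset, Measure.real]
  apply ENNReal.toReal_le_of_le_ofReal (by positivity)
  rw [gaussianReal_apply _ hs]
  calc ∫⁻ x in Set.Ioo (-t) t, gaussianPDF 0 s x
      ≤ ∫⁻ x in Set.Ioo (-t) t, ENNReal.ofReal ((√(2 * π * s))⁻¹) := by
        apply lintegral_mono
        intro x
        apply ENNReal.ofReal_le_ofReal
        rw [gaussianPDFReal]
        have : rexp (-(x - 0) ^ 2 / (2 * s)) ≤ 1 := by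
          rw [Real.exp_le_one_iff]
          apply div_nonpos_of_nonpos_of_nonneg
          · nlinarith [sq_nonneg (x - 0)]
          · positivity
        exact mul_le_of_le_one_right (by positivity) this
    _ = ENNReal.ofReal ((√(2 * π * s))⁻¹ * (2 * t)) := by
        rw [lintegral_const, Measure.restrict_apply_univ, Real.volume_Ioo,
          ← ENNReal.ofReal_mul (by positivity)]
        congr 1; ring
    _ ≤ ENNReal.ofReal (t / √s) := by
        apply ENNReal.ofReal_le_ofReal
        have h4 : 2 * √s ≤ √(2 * π * s) := by
          apply Real.le_sqrt_of_sq_le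
          rw [mul_pow, Real.sq_sqrt hs0.le]
          nlinarith [Real.pi_gt_three]
        have hp : 0 < √(s : ℝ) := Real.sqrt_pos.2 hs0
        rw [inv_mul_eq_div, div_le_div_iff₀ (by positivity) hp]
        nlinarith

lemma dot_small {d : ℕ} (v : Fin d → ℝ) (hv : 0 < nrm v) (t : ℝ) (ht : 0 ≤ t) :
    (Measure.pi fun _ : Fin d => gaussianReal 0 1).real {x | |dot v x| < t} ≤ t / nrm v := by
  have hs : 0 < ∑ j, (v j) ^ 2 := by
    unfold nrm at hv; exact Real.sqrt_pos.1 hv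
  have h := gauss_small (Real.toNNReal (∑ j, (v j) ^ 2)) (by simpa using hs) t ht
  rw [← dot_law v, map_measureReal_apply (measurable_dot v)
    (measurableSet_lt (by fun_prop) (by fun_prop)), Real.coe_toNNReal _ hs.le] at h
  exact h

lemma mgf_bound {Ω : Type*} [MeasurableSpace Ω] (μ : Measure Ω) [IsProbabilityMeasure μ]
    (Y : Ω → ℝ) (hY : Measurable Y) (h0 : ∀ x, 0 ≤ Y x) (l a p : ℝ) (hl : 0 ≤ l)
    (hp : μ.real {x | Y x < a} ≤ p) :
    Integrable (fun x => rexp (-l * Y x)) μ ∧ ∫ x, rexp (-l * Y x) ∂μ ≤ rexp (-l * a) + p := by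
  have hle : ∀ x, rexp (-l * Y x) ≤ 1 := fun x => by
    rw [Real.exp_le_one_iff]; nlinarith [mul_nonneg hl (h0 x)]
  have hi : Integrable (fun x => rexp (-l * Y x)) μ := by
    refine Integrable.of_bound (C := 1) (by fun_prop) ?_
    filter_upwards with x
    rw [Real.norm_eq_abs, abs_of_pos (Real.exp_pos _)]
    exact hle x
  refine ⟨hi, ?_⟩
  have hms : MeasurableSet {x | Y x < a} := measurableSet_lt hY measurable_const
  have hi2 : Integrable ({x | Y x < a}.indicator (fun _ => (1 : ℝ))) μ :=
    (integrable_const _).indicator hms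
  calc ∫ x, rexp (-l * Y x) ∂μ
      ≤ ∫ x, (rexp (-l * a) + {x | Y x < a}.indicator (fun _ => (1 : ℝ)) x) ∂μ := by
        apply integral_mono hi ((integrable_const _).add hi2)
        intro x
        by_cases hx : Y x < a
        · rw [Pi.add_apply, Set.indicator_of_mem (show x ∈ {x | Y x < a} from hx)]
          linarith [hle x, Real.exp_pos (-l * a)]
        · rw [Pi.add_apply, Set.indicator_of_notMem (show x ∉ {x | Y x < a} from hx), add_zero]
          apply Real.exp_le_exp.2
          nlinarith [not_lt.1 hx]
    _ = rexp (-l * a) + μ.real {x | Y x < a} := by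
        rw [integral_add (integrable_const _) hi2, integral_indicator_const _ hms]
        simp
    _ ≤ _ := by linarith

lemma chernoff {Ω : Type*} [MeasurableSpace Ω] (μ : Measure Ω) [IsProbabilityMeasure μ] (n : ℕ)
    (Z : Ω → ℝ) (hi : Integrable (fun x => rexp (Z x)) μ) (r s : ℝ)
    (hr : ∫ x, rexp (Z x) ∂μ ≤ r) :
    (Measure.pi fun _ : Fin n => μ).real {x | s * n ≤ ∑ i, Z (x i)} ≤ (rexp (-s) * r) ^ n := by
  have hI : Integrable (fun x : Fin n → Ω => ∏ i, rexp (Z (x i))) (Measure.pi fun _ => μ) :=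
    Integrable.fintype_prod (f := fun _ x => rexp (Z x)) (fun _ => hi)
  have hM := mul_meas_ge_le_integral_of_nonneg (μ := Measure.pi fun _ : Fin n => μ)
    (f := fun x : Fin n → Ω => ∏ i, rexp (Z (x i)))
    (Filter.Eventually.of_forall fun x => Finset.prod_nonneg fun i _ => (Real.exp_pos _).le)
    hI (rexp (s * n))
  rw [integral_fintype_prod_eq_pow (fun x => rexp (Z x)), Fintype.card_fin] at hM
  have hset : {x : Fin n → Ω | s * n ≤ ∑ i, Z (x i)}
      = {x | rexp (s * n) ≤ ∏ i, rexp (Z (x i))} := by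
    ext x
    simp only [Set.mem_ofPred_eq]
    rw [← Real.exp_sum, Real.exp_le_exp]
  rw [hset]
  have h0 : 0 ≤ ∫ x, rexp (Z x) ∂μ := integral_nonneg fun x => (Real.exp_pos _).le
  have h2 := pow_le_pow_left₀ h0 hr n
  rw [mul_pow, ← Real.exp_nat_mul]
  have h3 : rexp (n * -s) = (rexp (s * n))⁻¹ := by rw [← Real.exp_neg]; ring_nf
  rw [h3, inv_mul_eq_div, le_div_iff₀ (Real.exp_pos _)]
  linarith

lemma gauss_sq_mgf : Integrable (fun y : ℝ => rexp (1 / 4 * y ^ 2)) (gaussianReal 0 1) ∧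
    ∫ y, rexp (1 / 4 * y ^ 2) ∂(gaussianReal 0 1) ≤ √2 := by
  have hpt : ∀ y : ℝ, gaussianPDFReal 0 1 y * rexp (1 / 4 * y ^ 2)
      = (√(2 * π))⁻¹ * rexp (-(1 / 4) * y ^ 2) := by
    intro y
    simp only [gaussianPDFReal, NNReal.coe_one, mul_one, sub_zero]
    rw [mul_assoc, ← Real.exp_add]
    ring_nf
  constructor
  · rw [gaussianReal_of_var_ne_zero _ one_ne_zero,
      integrable_withDensity_iff_integrable_smul' (by fun_prop)
        (by filter_upwards with x; exact ENNReal.ofReal_lt_top)]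
    refine ((integrable_exp_neg_mul_sq (b := 1 / 4) (by norm_num)).const_mul
      ((√(2 * π))⁻¹)).congr ?_
    filter_upwards with y
    rw [← hpt y, toReal_gaussianPDF, smul_eq_mul]
  · rw [integral_gaussianReal_eq_integral_smul one_ne_zero]
    simp_rw [smul_eq_mul, hpt]
    rw [integral_const_mul, integral_gaussian, inv_mul_eq_div, ← Real.sqrt_div (by positivity)]
    apply le_of_eq
    congr 1
    have := Real.pi_pos
    field_simp
    norm_num

lemma trace_bound (n d : ℕ) (hd : 1 ≤ d) :
    (sample n d).real {x | 8 * (n : ℝ) * d ≤ ∑ i, ∑ j, (x i j) ^ 2} ≤ rexp (-(n : ℝ)) := by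
  obtain ⟨hg1, hg2⟩ := gauss_sq_mgf
  have hprod : ∀ x : Fin d → ℝ, rexp (1 / 4 * ∑ j, (x j) ^ 2)
      = ∏ j, rexp (1 / 4 * (x j) ^ 2) := by
    intro x
    rw [← Real.exp_sum, Finset.mul_sum]
  have hi : Integrable (fun x : Fin d → ℝ => rexp (1 / 4 * ∑ j, (x j) ^ 2))
      (Measure.pi fun _ : Fin d => gaussianReal 0 1) := by
    simp_rw [hprod]
    exact Integrable.fintype_prod (f := fun _ y => rexp (1 / 4 * y ^ 2)) (fun _ => hg1)
  have hr : ∫ x : Fin d → ℝ, rexp (1 / 4 * ∑ j, (x j) ^ 2)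
      ∂(Measure.pi fun _ : Fin d => gaussianReal 0 1) ≤ √2 ^ d := by
    simp_rw [hprod]
    rw [integral_fintype_prod_eq_pow (fun y : ℝ => rexp (1 / 4 * y ^ 2)), Fintype.card_fin]
    exact pow_le_pow_left₀ (integral_nonneg fun y => (Real.exp_pos _).le) hg2 d
  have hc := chernoff (Measure.pi fun _ : Fin d => gaussianReal 0 1) n
    (fun x => 1 / 4 * ∑ j, (x j) ^ 2) hi _ (2 * d) hr
  have hset : {x : Fin n → Fin d → ℝ | 8 * (n : ℝ) * d ≤ ∑ i, ∑ j, (x i j) ^ 2}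
      = {x | 2 * (d : ℝ) * n ≤ ∑ i, 1 / 4 * ∑ j, (x i j) ^ 2} := by
    ext x
    simp only [Set.mem_ofPred_eq]
    rw [← Finset.mul_sum]
    constructor <;> intro h <;> linarith
  rw [hset]
  refine hc.trans ?_
  have h2 : √2 ≤ rexp 1 := by
    have h3 : √2 ≤ 2 := by
      rw [Real.sqrt_le_left (by norm_num)]; norm_num
    linarith [Real.add_one_le_exp 1]
  have h4 : √2 ^ d ≤ rexp d := by
    have := pow_le_pow_left₀ (Real.sqrt_nonneg 2) h2 d
    rwa [← Real.exp_nat_mul, mul_one] at this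
  have h5 : rexp (-(2 * (d : ℝ))) * √2 ^ d ≤ rexp (-1) := by
    calc _ ≤ rexp (-(2 * (d : ℝ))) * rexp d := by gcongr
      _ = rexp (-(d : ℝ)) := by rw [← Real.exp_add]; ring_nf
      _ ≤ rexp (-1) := by
        apply Real.exp_le_exp.2
        have : (1 : ℝ) ≤ d := by exact_mod_cast hd
        linarith
  calc _ ≤ rexp (-1) ^ n := pow_le_pow_left₀ (by positivity) h5 n
    _ = rexp (-(n : ℝ)) := by rw [← Real.exp_nat_mul]; ring_nf

lemma dot_update {d : ℕ} (v y : Fin d → ℝ) (j : Fin d) (t : ℝ) :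
    dot (Function.update v j (v j + t)) y = dot v y + t * y j := by
  have : Function.update v j (v j + t) = v + t • Pi.single j (1 : ℝ) := by
    ext k
    by_cases hk : k = j
    · subst hk; simp
    · simp [hk]
  rw [this]
  simp only [dot, Pi.add_apply, Pi.smul_apply, smul_eq_mul, add_mul, Finset.sum_add_distrib]
  congr 1
  rw [Finset.sum_eq_single j]
  · simp
  · intro b _ hb; simp [hb]
  · simp

lemma rounding {n d : ℕ} (q : Fin n → ℝ) (hq : ∀ i, 0 ≤ q i) (x : Fin n → Fin d → ℝ)
    (u : Fin d → ℝ) (δ : ℝ) (hδ : 0 < δ) (S : Finset (Fin d)) :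
    ∃ v : Fin d → ℝ, (∀ j ∈ S, ∃ k : ℤ, v j = δ * k) ∧ (∀ j ∉ S, v j = u j) ∧
      (∀ j, |v j - u j| ≤ δ) ∧
      ∑ i, q i * (dot v (x i)) ^ 2 ≤
        ∑ i, q i * (dot u (x i)) ^ 2 + δ ^ 2 * ∑ j ∈ S, ∑ i, q i * (x i j) ^ 2 := by
  classical
  induction S using Finset.induction_on with
  | empty => exact ⟨u, by simp, by simp, by simp [hδ.le], by simp⟩
  | insert j S hj ih =>
    obtain ⟨v, h1, h2, h3, h4⟩ := ih
    set B := ∑ i, q i * (dot v (x i) * x i j) with hB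
    have key : ∃ t : ℝ, |t| ≤ δ ∧ t * B ≤ 0 ∧ ∃ k : ℤ, v j + t = δ * k := by
      have hf1 := Int.floor_le (v j / δ)
      have hf2 := Int.lt_floor_add_one (v j / δ)
      rw [le_div_iff₀ hδ] at hf1
      rw [div_lt_iff₀ hδ] at hf2
      rcases le_total 0 B with hb | hb
      · refine ⟨δ * ⌊v j / δ⌋ - v j, ?_, ?_, ⌊v j / δ⌋, by ring⟩
        · rw [abs_le]; constructor <;> nlinarith
        · apply mul_nonpos_of_nonpos_of_nonneg _ hb
          nlinarith
      · refine ⟨δ * (⌊v j / δ⌋ + 1) - v j, ?_, ?_, ⌊v j / δ⌋ + 1, by push_cast; ring⟩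
        · rw [abs_le]; constructor <;> nlinarith
        · apply mul_nonpos_of_nonneg_of_nonpos _ hb
          nlinarith
    obtain ⟨t, ht, htB, k, hk⟩ := key
    refine ⟨Function.update v j (v j + t), ?_, ?_, ?_, ?_⟩
    · intro l hl
      by_cases hlj : l = j
      · subst hlj; exact ⟨k, by simp [hk]⟩
      · obtain ⟨m, hm⟩ := h1 l (Finset.mem_of_mem_insert_of_ne hl hlj)
        exact ⟨m, by simp [hlj, hm]⟩
    · intro l hl
      rw [Finset.mem_insert, not_or] at hl
      simp [hl.1, h2 l hl.2]
    · intro l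
      by_cases hlj : l = j
      · subst hlj
        simpa [h2 l hj] using ht
      · simpa [hlj] using h3 l
    · simp_rw [dot_update]
      have he : ∑ i, q i * (dot v (x i) + t * x i j) ^ 2
          = ∑ i, q i * (dot v (x i)) ^ 2 + 2 * (t * B) + t ^ 2 * ∑ i, q i * (x i j) ^ 2 := by
        rw [hB, Finset.mul_sum, Finset.mul_sum, Finset.mul_sum, ← Finset.sum_add_distrib,
          ← Finset.sum_add_distrib]
        exact Finset.sum_congr rfl fun i _ => by ring
      rw [he, Finset.sum_insert hj]
      have ht2 : t ^ 2 ≤ δ ^ 2 := sq_le_sq' (abs_le.1 ht).1 (abs_le.1 ht).2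
      have hn : 0 ≤ ∑ i, q i * (x i j) ^ 2 :=
        Finset.sum_nonneg fun i _ => mul_nonneg (hq i) (sq_nonneg _)
      nlinarith [mul_le_mul_of_nonneg_right ht2 hn]

lemma theta_summable (e : ℝ) (he : 0 < e) : Summable fun k : ℤ => rexp (-e * (k : ℝ) ^ 2) := by
  have h1 : Summable fun k : ℤ => (1 / e) * (1 / (k : ℝ) ^ 2) :=
    (Real.summable_one_div_int_pow.2 (by norm_num)).mul_left _
  have h2 : Summable fun k : ℤ => (if k = 0 then (1 : ℝ) else 0) :=
    summable_of_ne_finset_zero (s := {0}) (by intro b hb; simp at hb; simp [hb])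
  refine Summable.of_nonneg_of_le (fun k => (Real.exp_pos _).le) (fun k => ?_) (h2.add h1)
  by_cases hk : k = 0
  · simp [hk]
  · have hk' : (0 : ℝ) < (k : ℝ) ^ 2 := by positivity
    simp only [hk, if_false, zero_add]
    rw [neg_mul, Real.exp_neg, ← one_div, one_div_mul_one_div]
    apply one_div_le_one_div_of_le (by positivity)
    linarith [Real.add_one_le_exp (e * (k : ℝ) ^ 2)]

lemma net (e : ℝ) (he : 0 < e) (he1 : e ≤ 1 / 4) :
    ∃ κ > (0 : ℝ), ∀ d : ℕ, 1 ≤ d → ∃ N : Finset (Fin d → ℝ),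
      (N.card : ℝ) ≤ rexp (κ * d) ∧ (∀ v ∈ N, 1 / 2 ≤ nrm v) ∧
      ∀ u : Fin d → ℝ, nrm u = 1 → ∀ (n : ℕ) (q : Fin n → ℝ) (x : Fin n → Fin d → ℝ),
        (∀ i, 0 ≤ q i) → (∀ i, q i ≤ 1) → ∃ v ∈ N,
          ∑ i, q i * (dot v (x i)) ^ 2 ≤
            ∑ i, q i * (dot u (x i)) ^ 2 + e / d * ∑ i, ∑ j, (x i j) ^ 2 := by
  classical
  have hsum := theta_summable e he
  set G := ∑' k : ℤ, rexp (-e * (k : ℝ) ^ 2) with hG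
  have hG1 : 1 ≤ G := by
    have := hsum.le_tsum 0 (fun j _ => (Real.exp_pos _).le)
    rw [← hG] at this
    simpa using this
  have hG0 : 0 < G := by linarith
  refine ⟨9 / 4 + Real.log G, by have := Real.log_nonneg hG1; linarith, fun d hd => ?_⟩
  have hd0 : (0 : ℝ) < d := by exact_mod_cast hd
  set δ := √(e / d) with hδdef
  have hδ : 0 < δ := Real.sqrt_pos.2 (by positivity)
  have hδ2 : δ ^ 2 = e / d := Real.sq_sqrt (by positivity)
  have hdδ : d * δ ^ 2 = e := by rw [hδ2]; field_simp
  obtain ⟨m, hm⟩ := exists_nat_ge (9 / 4 / δ ^ 2)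
  let P : Finset (Fin d → ℤ) := Fintype.piFinset fun _ => Finset.Icc (-(m : ℤ)) m
  let Q : Finset (Fin d → ℤ) := P.filter fun k =>
    1 / 4 ≤ ∑ j, (δ * (k j : ℝ)) ^ 2 ∧ ∑ j, (δ * (k j : ℝ)) ^ 2 ≤ 9 / 4
  refine ⟨Q.image fun k j => δ * (k j : ℝ), ?_, ?_, ?_⟩
  · have hcard : ((Q.image fun k j => δ * (k j : ℝ)).card : ℝ) ≤ Q.card := by
      exact_mod_cast Finset.card_image_le
    refine hcard.trans ?_
    calc (Q.card : ℝ) = ∑ k ∈ Q, (1 : ℝ) := by simp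
      _ ≤ ∑ k ∈ Q, rexp (9 / 4 * d) * ∏ j, rexp (-e * (k j : ℝ) ^ 2) := by
          apply Finset.sum_le_sum
          intro k hk
          rw [← Real.exp_sum, ← Real.exp_add]
          apply Real.one_le_exp
          have h := (Finset.mem_filter.1 hk).2.2
          have h5 : ∑ j, -e * (k j : ℝ) ^ 2 = - (d * ∑ j, (δ * (k j : ℝ)) ^ 2) := by
            rw [Finset.mul_sum, ← Finset.sum_neg_distrib]
            refine Finset.sum_congr rfl fun j _ => ?_
            rw [← hdδ]; ring
          rw [h5]
          nlinarith
      _ ≤ ∑ k ∈ P, rexp (9 / 4 * d) * ∏ j, rexp (-e * (k j : ℝ) ^ 2) := by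
          apply Finset.sum_le_sum_of_subset_of_nonneg (Finset.filter_subset _ _)
          intro k _ _
          positivity
      _ = rexp (9 / 4 * d) * (∑ k ∈ Finset.Icc (-(m : ℤ)) m, rexp (-e * (k : ℝ) ^ 2)) ^ d := by
          rw [← Finset.mul_sum]
          congr 1
          have := Finset.prod_univ_sum (fun _ : Fin d => Finset.Icc (-(m : ℤ)) m)
            (fun _ (k : ℤ) => rexp (-e * (k : ℝ) ^ 2))
          rw [Finset.prod_const, Finset.card_univ, Fintype.card_fin] at this
          rw [this]
      _ ≤ rexp (9 / 4 * d) * G ^ d := by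
          have h6 := hsum.sum_le_tsum (Finset.Icc (-(m : ℤ)) m) (fun j _ => (Real.exp_pos _).le)
          have h7 : 0 ≤ ∑ k ∈ Finset.Icc (-(m : ℤ)) m, rexp (-e * (k : ℝ) ^ 2) :=
            Finset.sum_nonneg fun j _ => (Real.exp_pos _).le
          have h8 := pow_le_pow_left₀ h7 h6 d
          gcongr
      _ = rexp ((9 / 4 + Real.log G) * d) := by
          rw [add_mul, Real.exp_add, mul_comm (Real.log G), Real.exp_nat_mul, Real.exp_log hG0]
  · intro v hv
    obtain ⟨k, hk, rfl⟩ := Finset.mem_image.1 hv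
    have h := (Finset.mem_filter.1 hk).2.1
    unfold nrm
    apply Real.le_sqrt_of_sq_le
    linarith
  · intro u hu n q x hq0 hq1
    obtain ⟨v, h1, -, h3, h4⟩ := rounding q hq0 x u δ hδ Finset.univ
    choose! k hk using h1
    have hvk : v = fun j => δ * (k j : ℝ) := funext fun j => hk j (Finset.mem_univ _)
    have hdist : ‖WithLp.toLp 2 v - WithLp.toLp 2 u‖ ≤ 1 / 2 := by
      rw [EuclideanSpace.norm_eq]
      apply Real.sqrt_le_iff.2 ⟨by norm_num, ?_⟩
      calc ∑ j, ‖(WithLp.toLp 2 v - WithLp.toLp 2 u) j‖ ^ 2 ≤ ∑ j : Fin d, δ ^ 2 := by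
            apply Finset.sum_le_sum
            intro j _
            apply pow_le_pow_left₀ (norm_nonneg _)
            simpa using h3 j
        _ = e := by simp [hdδ]
        _ ≤ _ := by linarith
    have hnu : ‖WithLp.toLp 2 u‖ = 1 := by rw [← nrm_eq_norm, hu]
    have hup : nrm v ≤ 3 / 2 := by
      rw [nrm_eq_norm]
      linarith [norm_sub_norm_le (WithLp.toLp 2 v) (WithLp.toLp 2 u)]
    have hlo : 1 / 2 ≤ nrm v := by
      rw [nrm_eq_norm]
      have := norm_sub_norm_le (WithLp.toLp 2 u) (WithLp.toLp 2 v)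
      rw [norm_sub_rev] at this
      linarith
    have hsq : nrm v ^ 2 = ∑ j, (δ * (k j : ℝ)) ^ 2 := by
      unfold nrm
      rw [Real.sq_sqrt (Finset.sum_nonneg fun j _ => sq_nonneg _), hvk]
    have hb1 : 1 / 4 ≤ ∑ j, (δ * (k j : ℝ)) ^ 2 := by rw [← hsq]; nlinarith
    have hb2 : ∑ j, (δ * (k j : ℝ)) ^ 2 ≤ 9 / 4 := by rw [← hsq]; nlinarith
    refine ⟨v, Finset.mem_image.2 ⟨k, Finset.mem_filter.2 ⟨?_, hb1, hb2⟩, hvk.symm⟩, ?_⟩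
    · rw [Fintype.mem_piFinset]
      intro j
      have hj : (δ * (k j : ℝ)) ^ 2 ≤ 9 / 4 :=
        (Finset.single_le_sum (f := fun j => (δ * (k j : ℝ)) ^ 2)
          (fun j _ => sq_nonneg _) (Finset.mem_univ j)).trans hb2
      have hj2 : (k j : ℝ) ^ 2 ≤ m := by
        refine le_trans ?_ hm
        rw [le_div_iff₀ (by positivity)]
        nlinarith
      have hj3 : (k j) ^ 2 ≤ (m : ℤ) := by exact_mod_cast hj2
      rw [Finset.mem_Icc]
      have ha := Int.le_self_sq (k j)
      have hb := Int.le_self_sq (-(k j))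
      rw [neg_sq] at hb
      constructor <;> linarith
    · refine h4.trans ?_
      rw [hδ2, Finset.sum_comm]
      gcongr with i _ j _
      exact mul_le_of_le_one_left (sq_nonneg _) (hq1 i)

/-- Truncated weight: indicator that `|⟨w, y⟩| ≥ 1/16`. -/
def wt {d : ℕ} (w y : Fin d → ℝ) : ℝ := {y : Fin d → ℝ | 1 / 16 ≤ |dot w y|}.indicator 1 y

lemma wt_nonneg {d : ℕ} (w y : Fin d → ℝ) : 0 ≤ wt w y :=
  Set.indicator_nonneg (fun _ _ => zero_le_one) _

lemma wt_le_one {d : ℕ} (w y : Fin d → ℝ) : wt w y ≤ 1 :=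
  Set.indicator_le' (fun _ _ => le_refl _) (fun _ _ => zero_le_one) _

lemma wt_of_le {d : ℕ} (w y : Fin d → ℝ) (h : 1 / 16 ≤ |dot w y|) : wt w y = 1 :=
  Set.indicator_of_mem (s := {y : Fin d → ℝ | 1 / 16 ≤ |dot w y|}) h 1

lemma wt_of_lt {d : ℕ} (w y : Fin d → ℝ) (h : |dot w y| < 1 / 16) : wt w y = 0 :=
  Set.indicator_of_notMem (s := {y : Fin d → ℝ | 1 / 16 ≤ |dot w y|}) (not_le.2 h) 1

lemma measurable_wt {d : ℕ} (w : Fin d → ℝ) : Measurable (wt w) := by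
  have := measurable_dot w
  exact measurable_one.indicator (measurableSet_le (by fun_prop) (by fun_prop))

lemma wt_le {d : ℕ} (w y : Fin d → ℝ) : wt w y / 256 ≤ (dot w y) ^ 2 := by
  rcases le_or_gt (1 / 16) |dot w y| with h | h
  · rw [wt_of_le w y h, ← sq_abs]
    nlinarith
  · rw [wt_of_lt w y h]
    nlinarith [sq_nonneg (dot w y)]

lemma point_bound (n d : ℕ) (w v : Fin d → ℝ) (hw : nrm w = 1) (hv : 1 / 2 ≤ nrm v) :
    (sample n d).real {x | ∑ i, wt w (x i) * (dot v (x i)) ^ 2 ≤ (n : ℝ) / 3072}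
      ≤ rexp (-(n : ℝ) / 5) := by
  have hmv := measurable_dot v
  have hmw := measurable_wt w
  have hp : (Measure.pi fun _ : Fin d => gaussianReal 0 1).real
      {y | wt w y * (dot v y) ^ 2 < 1 / 1024} ≤ 1 / 8 := by
    have hsub : {y | wt w y * (dot v y) ^ 2 < 1 / 1024} ⊆
        {y | |dot w y| < 1 / 16} ∪ {y | |dot v y| < 1 / 32} := by
      intro y hy
      simp only [Set.mem_ofPred_eq] at hy
      rcases le_or_gt (1 / 16) |dot w y| with h | h
      · right
        rw [wt_of_le w y h, one_mul, ← sq_abs] at hy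
        simp only [Set.mem_ofPred_eq]
        by_contra hc
        nlinarith [not_lt.1 hc]
      · left; exact h
    have h1 := dot_small w (by rw [hw]; norm_num) (1 / 16) (by norm_num)
    have h2 := dot_small v (by linarith) (1 / 32) (by norm_num)
    rw [hw] at h1
    have h3 : 1 / 32 / nrm v ≤ 1 / 16 := by
      rw [div_le_iff₀ (by linarith)]; linarith
    calc _ ≤ _ := measureReal_mono hsub
      _ ≤ _ := measureReal_union_le _ _
      _ ≤ _ := by linarith
  obtain ⟨hi, hr⟩ := mgf_bound (Measure.pi fun _ : Fin d => gaussianReal 0 1)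
    (fun y => wt w y * (dot v y) ^ 2) (by fun_prop)
    (fun y => mul_nonneg (wt_nonneg w y) (sq_nonneg _)) 3072 (1 / 1024) (1 / 8) (by norm_num) hp
  have hc := chernoff _ n (fun y => -3072 * (wt w y * (dot v y) ^ 2)) hi _ (-1) hr
  have hset : {x : Fin n → Fin d → ℝ | ∑ i, wt w (x i) * (dot v (x i)) ^ 2 ≤ (n : ℝ) / 3072}
      = {x | -1 * (n : ℝ) ≤ ∑ i, -3072 * (wt w (x i) * (dot v (x i)) ^ 2)} := by
    ext x
    simp only [Set.mem_ofPred_eq]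
    rw [← Finset.mul_sum]
    constructor <;> intro h <;> linarith
  rw [hset]
  refine hc.trans ?_
  have hb : rexp (- -1) * (rexp (-3072 * (1 / 1024)) + 1 / 8) ≤ rexp (-(1 / 5)) := by
    have h1 : rexp (- -1) * rexp (-3072 * (1 / 1024)) = (rexp 1 * rexp 1)⁻¹ := by
      rw [← Real.exp_add, ← Real.exp_add, ← Real.exp_neg]; norm_num
    have h2 := Real.exp_one_lt_d9
    have h3 := Real.exp_one_gt_d9
    have h4 : (rexp 1 * rexp 1)⁻¹ ≤ (4 : ℝ)⁻¹ := by
      apply inv_anti₀ (by norm_num); nlinarith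
    have h5 := Real.add_one_le_exp (-(1 / 5) : ℝ)
    rw [mul_add, h1, neg_neg]
    norm_num at h4 h5 ⊢
    linarith
  calc _ ≤ rexp (-(1 / 5)) ^ n := pow_le_pow_left₀ (by positivity) hb n
    _ = _ := by rw [← Real.exp_nat_mul]; ring_nf

instance sample_prob (n d : ℕ) : IsProbabilityMeasure (sample n d) := by
  unfold sample _root_.stdGaussian
  infer_instance

/-- **Lemma 3.4**: there exist absolute constants `C, c > 0` such that if `n ≥ C d`, then with
probability at least `1 - C/n - C e^{-c n}`, the Hessian at the ground truth is positive
definite: `u^⊤ ∇²L(w*) u = (2/n) Σ_i (u^⊤ x_i)² (w*^⊤ x_i)² ≥ c > 0` for all unit `u`. -/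
theorem stmt5 :
    ∃ C > (0 : ℝ), ∃ c > (0 : ℝ),
      ∀ (n d : ℕ) (wstar : Fin d → ℝ),
        nrm wstar = 1 → C * (d : ℝ) ≤ (n : ℝ) →
        1 - C / n - C * Real.exp (-c * n) ≤
          (sample n d {x | ∀ u : Fin d → ℝ, nrm u = 1 →
              c ≤ (2 / n) * ∑ i, (dot u (x i)) ^ 2 * (dot wstar (x i)) ^ 2}).toReal := by
  obtain ⟨κ, hκ, hnet⟩ := net (1 / 49152) (by norm_num) (by norm_num)
  refine ⟨10 * κ + 2, by positivity, 1 / 786432, by norm_num, ?_⟩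
  intro n d w hw hn
  have hd : 1 ≤ d := by
    rcases Nat.eq_zero_or_pos d with h | h
    · subst h; simp [nrm] at hw
    · exact h
  have hd0 : (1 : ℝ) ≤ d := by exact_mod_cast hd
  have hn0 : (0 : ℝ) < n := by nlinarith
  obtain ⟨N, hN1, hN2, hN3⟩ := hnet d hd
  set A := {x : Fin n → Fin d → ℝ | ∀ u : Fin d → ℝ, nrm u = 1 →
    1 / 786432 ≤ (2 / (n : ℝ)) * ∑ i, (dot u (x i)) ^ 2 * (dot w (x i)) ^ 2} with hA
  set T := {x : Fin n → Fin d → ℝ | 8 * (n : ℝ) * d ≤ ∑ i, ∑ j, (x i j) ^ 2} with hT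
  set U := ⋃ v ∈ N, {x : Fin n → Fin d → ℝ |
    ∑ i, wt w (x i) * (dot v (x i)) ^ 2 ≤ (n : ℝ) / 3072} with hU
  have hcover : Set.univ ⊆ A ∪ (T ∪ U) := by
    intro x _
    by_cases hxT : x ∈ T
    · exact Or.inr (Or.inl hxT)
    by_cases hxU : x ∈ U
    · exact Or.inr (Or.inr hxU)
    left
    intro u hu
    obtain ⟨v, hv, hle⟩ := hN3 u hu n (fun i => wt w (x i)) x (fun i => wt_nonneg _ _)
      (fun i => wt_le_one _ _)
    have hT' : ∑ i, ∑ j, (x i j) ^ 2 < 8 * (n : ℝ) * d := not_le.1 hxT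
    have hU' : (n : ℝ) / 3072 < ∑ i, wt w (x i) * (dot v (x i)) ^ 2 := by
      by_contra hc
      exact hxU (Set.mem_biUnion hv (not_lt.1 hc))
    have h1 : (1 / 49152 : ℝ) / d * ∑ i, ∑ j, (x i j) ^ 2 ≤ n / 6144 := by
      calc _ ≤ (1 / 49152 : ℝ) / d * (8 * (n : ℝ) * d) := by gcongr
        _ = _ := by field_simp; norm_num
    have h2 : (n : ℝ) / 6144 ≤ ∑ i, wt w (x i) * (dot u (x i)) ^ 2 := by linarith
    have h3 : (∑ i, wt w (x i) * (dot u (x i)) ^ 2) / 256 ≤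
        ∑ i, (dot u (x i)) ^ 2 * (dot w (x i)) ^ 2 := by
      rw [Finset.sum_div]
      apply Finset.sum_le_sum
      intro i _
      have := mul_le_mul_of_nonneg_left (wt_le w (x i)) (sq_nonneg (dot u (x i)))
      linarith
    rw [div_mul_eq_mul_div, le_div_iff₀ hn0]
    linarith
  have hTb : (sample n d).real T ≤ rexp (-(n : ℝ)) := trace_bound n d hd
  have hUb : (sample n d).real U ≤ rexp (-(n : ℝ) / 10) := by
    calc (sample n d).real U ≤ ∑ v ∈ N, (sample n d).real {x : Fin n → Fin d → ℝ |
            ∑ i, wt w (x i) * (dot v (x i)) ^ 2 ≤ (n : ℝ) / 3072} :=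
          measureReal_biUnion_finset_le _ _
      _ ≤ ∑ v ∈ N, rexp (-(n : ℝ) / 5) :=
          Finset.sum_le_sum fun v hv => point_bound n d w v hw (hN2 v hv)
      _ = N.card * rexp (-(n : ℝ) / 5) := by simp
      _ ≤ rexp (κ * d) * rexp (-(n : ℝ) / 5) := by gcongr
      _ ≤ rexp (-(n : ℝ) / 10) := by
          rw [← Real.exp_add]
          apply Real.exp_le_exp.2
          nlinarith
  have hone : 1 ≤ (sample n d).real A + ((sample n d).real T + (sample n d).real U) := by
    calc (1 : ℝ) = (sample n d).real Set.univ := by simp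
      _ ≤ (sample n d).real (A ∪ (T ∪ U)) := measureReal_mono hcover
      _ ≤ (sample n d).real A + (sample n d).real (T ∪ U) := measureReal_union_le _ _
      _ ≤ _ := by gcongr; exact measureReal_union_le _ _
  change _ ≤ (sample n d).real A
  have h1 : rexp (-(n : ℝ)) ≤ rexp (-(1 / 786432) * n) := Real.exp_le_exp.2 (by linarith)
  have h2 : rexp (-(n : ℝ) / 10) ≤ rexp (-(1 / 786432) * n) := Real.exp_le_exp.2 (by linarith)
  have h3 : 0 ≤ (10 * κ + 2) / n := by positivity
  have h4 : 0 ≤ κ * rexp (-(1 / 786432) * n) := by positivity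
  linarith
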